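/- Let k be a perfect field and R, S finite-dimensional k-algebras. Then the Jacobson radical of R ⊗_k S satisfies rad(R ⊗_k S) = rad(R) ⊗_k S + R ⊗_k rad(S) as ideals of R ⊗_k S. -/

import Mathlib

open TensorProduct

/-- Every nonzero two-sided ideal contains a nonzero central element. -/
def HasCentral (A : Type*) [Ring A] : Prop :=
  ∀ P : TwoSidedIdeal A, (∃ a ∈ P, a ≠ 0) → ∃ z ∈ P, z ≠ 0 ∧ ∀ a, a * z = z * a

lemma hasCentral_pi {ι : Type*} [DecidableEq ι] (R : ι → Type*) [∀ i, Ring (R i)]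
    [∀ i, IsSimpleRing (R i)] : HasCentral (∀ i, R i) := by
  rintro P ⟨a, haP, ha⟩
  obtain ⟨i, hi⟩ := Function.ne_iff.mp ha
  let Q : TwoSidedIdeal (R i) := TwoSidedIdeal.mk' {r | Pi.single i r ∈ P}
    (by simp [P.zero_mem])
    (by intro x y hx hy; simpa [Pi.single_add] using P.add_mem hx hy)
    (by intro x hx; simpa [Pi.single_neg] using P.neg_mem hx)
    (by intro x y hy; simpa [Pi.single_mul] using P.mul_mem_left (Pi.single i x) _ hy)
    (by intro x y hx; simpa [Pi.single_mul] using P.mul_mem_right _ (Pi.single i y) hx)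
  have hQ : ∀ r, r ∈ Q ↔ Pi.single i r ∈ P := by
    intro r; simp [Q, TwoSidedIdeal.mem_mk']
  have h1 : a i ∈ Q := by
    rw [hQ]
    have := P.mul_mem_right _ (Pi.single i 1) haP
    convert this using 1
    ext j
    by_cases h : j = i
    · subst h; simp
    · simp [h]
  have h2 := IsSimpleRing.one_mem_of_ne_zero_mem Q hi h1
  refine ⟨_, (hQ 1).1 h2, ?_, ?_⟩
  · intro h
    have := congrFun h i
    simp at this
  · intro b
    ext j
    by_cases h : j = i
    · subst h; simp
    · simp [h]

lemma HasCentral.of_equiv {A B : Type*} [Ring A] [Ring B] (e : A ≃+* B) (h : HasCentral B) :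
    HasCentral A := by
  rintro P ⟨a, haP, ha⟩
  obtain ⟨z, hz, hz0, hzc⟩ := h (P.comap e.symm) ⟨e a, by simpa [TwoSidedIdeal.mem_comap], by simpa⟩
  refine ⟨e.symm z, by simpa [TwoSidedIdeal.mem_comap] using hz, by simpa, fun b => ?_⟩
  apply e.injective
  simp [hzc]

lemma hasCentral_of_semisimple (A : Type*) [Ring A] [IsSemisimpleRing A] : HasCentral A := by
  obtain ⟨n, D, d, _, _, ⟨e⟩⟩ := IsSemisimpleRing.exists_ringEquiv_pi_matrix_divisionRing A
  exact .of_equiv e (hasCentral_pi _)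

lemma finsupp_central {ι A : Type*} [Ring A] (hA : HasCentral A)
    (N : AddSubgroup (ι →₀ A)) (hl : ∀ a : A, ∀ f ∈ N, a • f ∈ N)
    (hr : ∀ a : A, ∀ f ∈ N, (MulOpposite.op a) • f ∈ N) (h0 : ∃ f ∈ N, f ≠ 0) :
    ∃ g ∈ N, g ≠ 0 ∧ ∀ j a, a * g j = g j * a := by
  classical
  obtain ⟨f, ⟨hfN, hf0⟩, hmin⟩ := WellFounded.has_min
    (InvImage.wf (fun f : ι →₀ A => f.support.card) Nat.lt_wfRel.wf)
    {f | f ∈ N ∧ f ≠ 0} h0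
  have hmin' : ∀ g ∈ N, g.support ⊂ f.support → g = 0 := by
    intro g hg hlt
    by_contra hne
    exact hmin g ⟨hg, hne⟩ (Finset.card_lt_card hlt)
  obtain ⟨i, hi⟩ := Finsupp.ne_iff.mp hf0
  let P : TwoSidedIdeal A := TwoSidedIdeal.mk' {a | ∃ g ∈ N, g.support ⊆ f.support ∧ g i = a}
    ⟨0, N.zero_mem, by simp, by simp⟩
    (by
      rintro _ _ ⟨g, hg, hs, rfl⟩ ⟨g', hg', hs', rfl⟩
      exact ⟨g + g', N.add_mem hg hg', Finsupp.support_add.trans (Finset.union_subset hs hs'),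
        by simp⟩)
    (by
      rintro _ ⟨g, hg, hs, rfl⟩
      exact ⟨-g, N.neg_mem hg, by simpa using hs, by simp⟩)
    (by
      rintro a _ ⟨g, hg, hs, rfl⟩
      exact ⟨a • g, hl a g hg, Finsupp.support_smul.trans hs, by simp⟩)
    (by
      rintro _ a ⟨g, hg, hs, rfl⟩
      exact ⟨MulOpposite.op a • g, hr a g hg, Finsupp.support_smul.trans hs, by simp⟩)
  have hP : ∀ a, a ∈ P ↔ ∃ g ∈ N, g.support ⊆ f.support ∧ g i = a := by
    intro r; simp [P, TwoSidedIdeal.mem_mk']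
  obtain ⟨z, hz, hz0, hzc⟩ := hA P ⟨f i, (hP _).2 ⟨f, hfN, subset_rfl, rfl⟩, hi⟩
  obtain ⟨g, hg, hs, rfl⟩ := (hP _).1 hz
  refine ⟨g, hg, fun h => hz0 (by simp [h]), fun j a => ?_⟩
  have := hmin' (a • g - MulOpposite.op a • g) (N.sub_mem (hl a g hg) (hr a g hg)) (by
    refine (Finset.ssubset_iff_of_subset ?_).2 ⟨i, by simpa using hi, by simp [hzc]⟩
    exact (Finsupp.support_sub).trans (Finset.union_subset (Finsupp.support_smul.trans hs)
      (Finsupp.support_smul.trans hs)))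
  have := DFunLike.congr_fun this j
  simpa [sub_eq_zero] using this

lemma tensor_central {k A V : Type*} [Field k] [Ring A] [Algebra k A] [AddCommGroup V] [Module k V]
    (hA : HasCentral A) (N : AddSubgroup (A ⊗[k] V))
    (hl : ∀ a : A, ∀ f ∈ N, (LinearMap.mulLeft k a).rTensor V f ∈ N)
    (hr : ∀ a : A, ∀ f ∈ N, (LinearMap.mulRight k a).rTensor V f ∈ N) (h0 : ∃ f ∈ N, f ≠ 0) :
    ∃ w : (Subalgebra.center k A) ⊗[k] V, w ≠ 0 ∧
      (Subalgebra.center k A).val.toLinearMap.rTensor V w ∈ N := by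
  classical
  let b := Module.Basis.ofVectorSpace k V
  let e := TensorProduct.equivFinsuppOfBasisRight (M := A) b
  have el : ∀ a x, e ((LinearMap.mulLeft k a).rTensor V x) = a • e x := by
    intro a x
    induction x with
    | zero => simp
    | add x y hx hy => simp [hx, hy]
    | tmul x y => ext; simp [e]
  have er : ∀ a x, e ((LinearMap.mulRight k a).rTensor V x) = MulOpposite.op a • e x := by
    intro a x
    induction x with
    | zero => simp
    | add x y hx hy => simp [hx, hy]
    | tmul x y => ext; simp [e]
  obtain ⟨f, hf, hf0⟩ := h0
  obtain ⟨g, hg, hg0, hgc⟩ := finsupp_central hA (N.map e.toAddMonoidHom)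
    (by
      rintro a _ ⟨x, hx, rfl⟩
      exact ⟨_, hl a x hx, el a x⟩)
    (by
      rintro a _ ⟨x, hx, rfl⟩
      exact ⟨_, hr a x hx, er a x⟩)
    ⟨e f, ⟨f, hf, rfl⟩, by simpa using hf0⟩
  obtain ⟨x, hx, rfl⟩ := hg
  have hx' : x = (e x).sum fun i m => m ⊗ₜ b i := by
    have := TensorProduct.equivFinsuppOfBasisRight_symm_apply b (e x)
    rw [← this]
    exact (e.symm_apply_apply x).symm
  let w : (Subalgebra.center k A) ⊗[k] V := ∑ i ∈ (e x).support,
    (⟨e x i, Subalgebra.mem_center_iff.2 fun a => hgc i a⟩ : Subalgebra.center k A) ⊗ₜ b i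
  have hw : (Subalgebra.center k A).val.toLinearMap.rTensor V w = x := by
    conv_rhs => rw [hx']
    simp [w, Finsupp.sum]
  refine ⟨w, ?_, by rw [hw]; exact hx⟩
  intro h
  rw [h, map_zero] at hw
  apply hg0
  simp [← hw]

lemma unram {k Z : Type*} [Field k] [PerfectField k] [CommRing Z] [Algebra k Z]
    [FiniteDimensional k Z] [IsReduced Z] : Algebra.FormallyUnramified k Z := by
  have : IsArtinianRing Z := IsArtinianRing.of_finite k Z
  have : ∀ I : MaximalSpectrum Z, Algebra.FormallyUnramified k (Z ⧸ I.asIdeal) := fun I =>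
    letI : Field (Z ⧸ I.asIdeal) := Ideal.Quotient.field I.asIdeal
    Algebra.FormallyUnramified.of_isSeparable _ _
  exact Algebra.FormallyUnramified.of_equiv ((IsArtinianRing.equivPi Z).restrictScalars k).symm

lemma red {k Z W : Type*} [Field k] [PerfectField k] [CommRing Z] [Algebra k Z]
    [FiniteDimensional k Z] [IsReduced Z] [CommRing W] [Algebra k W]
    [FiniteDimensional k W] [IsReduced W] : IsReduced (Z ⊗[k] W) := by
  have := unram (k := k) (Z := Z)
  have := unram (k := k) (Z := W)
  have : Algebra.FormallyUnramified k (Z ⊗[k] W) := Algebra.FormallyUnramified.comp k Z _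
  exact Algebra.FormallyUnramified.isReduced_of_field k _

lemma center_red {k A : Type*} [Field k] [Ring A] [Algebra k A] [IsSemisimpleRing A] :
    IsReduced (Subalgebra.center k A) := by
  refine ⟨fun x hx => ?_⟩
  have hxn : IsNilpotent (x : A) := hx.map (Subalgebra.center k A).val
  have : (x : A) ∈ Ring.jacobson A := by
    rw [← Ideal.jacobson_bot, Ideal.mem_jacobson_iff]
    intro y
    have hc : Commute y (x : A) := Subalgebra.mem_center_iff.1 x.2 y
    obtain ⟨u, hu⟩ := (hc.isNilpotent_mul_left hxn).isUnit_one_add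
    refine ⟨↑u⁻¹, ?_⟩
    have : (↑u⁻¹ : A) * (1 + y * x) = 1 := by rw [← hu]; simp
    rw [mul_add, mul_one, ← mul_assoc] at this
    simp [add_comm, this]
  rw [IsSemisimpleRing.jacobson_eq_bot] at this
  simpa using this
lemma incl_mem {k R S T : Type*} [Field k] [Ring R] [Algebra k R] [FiniteDimensional k R]
    [Ring S] [Algebra k S] [Ring T] [Algebra k T] (f : R →ₐ[k] T) (g : S →ₐ[k] T)
    (hc : ∀ r s, Commute (f r) (g s)) (htop : ∀ t : T, t ∈ (⊤ : Submodule k S).map g.toLinearMap *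
      (⊤ : Submodule k R).map f.toLinearMap) (x : R)
    (hx : x ∈ TwoSidedIdeal.jacobson (⊥ : TwoSidedIdeal R)) :
    f x ∈ TwoSidedIdeal.jacobson (⊥ : TwoSidedIdeal T) := by
  have : IsArtinianRing R := IsArtinianRing.of_finite k R
  obtain ⟨n, hn⟩ := IsArtinianRing.isNilpotent_jacobson_bot (R := R)
  have hx : x ∈ Ideal.jacobson (⊥ : Ideal R) := by simpa [TwoSidedIdeal.jacobson] using hx
  rw [TwoSidedIdeal.mem_jacobson_iff]
  intro y
  let J : Submodule k R := (Ideal.jacobson (⊥ : Ideal R)).restrictScalars k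
  let S' := (⊤ : Submodule k S).map g.toLinearMap
  let J' := J.map f.toLinearMap
  have hJ : J ^ (n + 1) = ⊥ := by
    have h2 : ∀ m, J ^ (m + 1) ≤ ((Ideal.jacobson (⊥ : Ideal R)) ^ (m + 1)).restrictScalars k := by
      intro m
      induction m with
      | zero => simp [J, Submodule.pow_one]
      | succ m ih =>
        rw [pow_succ, Submodule.mul_le]
        intro a ha b hb
        have := Ideal.mul_mem_mul (ih ha) hb
        rw [← Submodule.pow_succ] at this
        exact this
    rw [eq_bot_iff]
    refine (h2 n).trans ?_
    rw [Submodule.pow_succ, hn]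
    simp
  have hcomm : Commute S' J' := by
    apply le_antisymm
    · rw [Submodule.mul_le]
      rintro _ ⟨s, hs, rfl⟩ _ ⟨r, hr, rfl⟩
      have : g s * f r = f r * g s := (hc r s).eq.symm
      exact this ▸ Submodule.mul_mem_mul ⟨r, hr, rfl⟩ ⟨s, hs, rfl⟩
    · rw [Submodule.mul_le]
      rintro _ ⟨r, hr, rfl⟩ _ ⟨s, hs, rfl⟩
      have : f r * g s = g s * f r := (hc r s).eq
      exact this ▸ Submodule.mul_mem_mul ⟨s, hs, rfl⟩ ⟨r, hr, rfl⟩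
  have hmem : y * f x ∈ S' * J' := by
    have h1 : y * f x ∈ (S' * (⊤ : Submodule k R).map f.toLinearMap) * J' :=
      Submodule.mul_mem_mul (htop y) ⟨x, hx, rfl⟩
    rw [mul_assoc] at h1
    refine mul_le_mul_right (α := Submodule k T) ?_ _ h1
    rw [← Submodule.map_mul]
    apply Submodule.map_mono
    rw [Submodule.mul_le]
    intro a _ b hb
    exact Ideal.mul_mem_left _ _ hb
  have hnil : IsNilpotent (y * f x) := by
    refine ⟨n + 1, ?_⟩
    have := Submodule.pow_mem_pow _ hmem (n + 1)
    rw [hcomm.mul_pow, show J' ^ (n + 1) = ⊥ by rw [← Submodule.map_pow, hJ]; simp] at this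
    simpa using this
  obtain ⟨u, hu⟩ := hnil.isUnit_one_add
  refine ⟨↑u⁻¹, ?_⟩
  have : (↑u⁻¹ : T) * (1 + y * f x) = 1 := by rw [← hu]; simp
  rw [mul_add, mul_one, ← mul_assoc] at this
  rw [add_comm, this]
  simp

lemma tensor_jacobson {k A B : Type*} [Field k] [PerfectField k]
    [Ring A] [Algebra k A] [FiniteDimensional k A] [IsSemisimpleRing A]
    [Ring B] [Algebra k B] [FiniteDimensional k B] [IsSemisimpleRing B] :
    Ring.jacobson (A ⊗[k] B) = ⊥ := by
  have : IsArtinianRing (A ⊗[k] B) := IsArtinianRing.of_finite k _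
  have hnil : ∀ x ∈ Ring.jacobson (A ⊗[k] B), IsNilpotent x := by
    intro x hx
    obtain ⟨n, hn⟩ := IsArtinianRing.isNilpotent_jacobson_bot (R := A ⊗[k] B)
    rw [Ideal.jacobson_bot] at hn
    exact ⟨n, by simpa [hn] using Ideal.pow_mem_pow hx n⟩
  by_contra hne
  obtain ⟨x, hx, hx0⟩ := Submodule.exists_mem_ne_zero_of_ne_bot hne
  obtain ⟨w, hw0, hw⟩ := tensor_central (k := k) (V := B) (hasCentral_of_semisimple A)
    (Ring.jacobson (A ⊗[k] B)).toAddSubgroup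
    (by
      intro a f hf
      have : (LinearMap.mulLeft k a).rTensor B f = (a ⊗ₜ 1) * f := by
        clear hf
        induction f with
        | zero => simp
        | add x y hx hy => simp [mul_add, hx, hy]
        | tmul x y => simp
      rw [this]
      exact Ideal.mul_mem_left _ _ hf)
    (by
      intro a f hf
      have : (LinearMap.mulRight k a).rTensor B f = f * (a ⊗ₜ 1) := by
        clear hf
        induction f with
        | zero => simp
        | add x y hx hy => simp [add_mul, hx, hy]
        | tmul x y => simp
      rw [this]
      exact Ideal.mul_mem_right _ _ hf)
    ⟨x, hx, hx0⟩
  let φ : B ⊗[k] Subalgebra.center k A →ₐ[k] A ⊗[k] B :=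
    (Algebra.TensorProduct.map (Subalgebra.center k A).val (AlgHom.id k B)).comp
      (Algebra.TensorProduct.comm k B (Subalgebra.center k A)).toAlgHom
  obtain ⟨v, hv0, hv⟩ := tensor_central (k := k) (V := Subalgebra.center k A)
    (hasCentral_of_semisimple B)
    ((Ring.jacobson (A ⊗[k] B)).toAddSubgroup.comap (φ : _ →+ A ⊗[k] B))
    (by
      intro a f hf
      have : (LinearMap.mulLeft k a).rTensor _ f = (a ⊗ₜ 1) * f := by
        clear hf
        induction f with
        | zero => simp
        | add x y hx hy => simp [mul_add, hx, hy]
        | tmul x y => simp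
      rw [this]
      change φ _ ∈ Ring.jacobson (A ⊗[k] B)
      rw [map_mul]
      exact Ideal.mul_mem_left _ _ hf)
    (by
      intro a f hf
      have : (LinearMap.mulRight k a).rTensor _ f = f * (a ⊗ₜ 1) := by
        clear hf
        induction f with
        | zero => simp
        | add x y hx hy => simp [add_mul, hx, hy]
        | tmul x y => simp
      rw [this]
      change φ _ ∈ Ring.jacobson (A ⊗[k] B)
      rw [map_mul]
      exact Ideal.mul_mem_right _ _ hf)
    ⟨(Algebra.TensorProduct.comm k B (Subalgebra.center k A)).symm w, by
      change φ _ ∈ Ring.jacobson (A ⊗[k] B)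
      simp only [φ, AlgHom.comp_apply]
      convert hw
      simp
      rfl, by simpa using hw0⟩
  have hφ : Function.Injective φ := by
    have : Function.Injective (Algebra.TensorProduct.map (Subalgebra.center k A).val
        (AlgHom.id k B)) :=
      Module.Flat.rTensor_preserves_injective_linearMap (M := B)
        (Subalgebra.center k A).val.toLinearMap Subtype.val_injective
    exact this.comp (Algebra.TensorProduct.comm k B (Subalgebra.center k A)).injective
  let ψ : Subalgebra.center k B ⊗[k] Subalgebra.center k A →ₐ[k] B ⊗[k] Subalgebra.center k A :=
    Algebra.TensorProduct.map (Subalgebra.center k B).val (AlgHom.id k _)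
  have hψ : Function.Injective ψ :=
      Module.Flat.rTensor_preserves_injective_linearMap (M := Subalgebra.center k A)
        (Subalgebra.center k B).val.toLinearMap Subtype.val_injective
  have h1 : IsNilpotent (φ (ψ v)) := hnil _ hv
  rw [IsNilpotent.map_iff hφ, IsNilpotent.map_iff hψ] at h1
  have := center_red (k := k) (A := A)
  have := center_red (k := k) (A := B)
  have := red (k := k) (Z := Subalgebra.center k B) (W := Subalgebra.center k A)
  exact hv0 h1.eq_zero



/-- Let `k` be a perfect field and `R`, `S` finite-dimensional `k`-algebras.
Then the Jacobson radical of `R ⊗_k S` satisfies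
`rad(R ⊗_k S) = rad(R) ⊗_k S + R ⊗_k rad(S)` as (two-sided) ideals of `R ⊗_k S`, where the
right-hand side is the sum of the two-sided ideals generated by the canonical images of
`rad R` and `rad S`. -/
theorem stmt4 (k : Type) [Field k] [PerfectField k]
    (R S : Type) [Ring R] [Algebra k R] [FiniteDimensional k R]
    [Ring S] [Algebra k S] [FiniteDimensional k S] :
    TwoSidedIdeal.jacobson (⊥ : TwoSidedIdeal (R ⊗[k] S)) =
      TwoSidedIdeal.span ((Algebra.TensorProduct.includeLeft (R := k) (S := k) :
          R →ₐ[k] R ⊗[k] S) '' (TwoSidedIdeal.jacobson (⊥ : TwoSidedIdeal R))) ⊔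
      TwoSidedIdeal.span ((Algebra.TensorProduct.includeRight :
          S →ₐ[k] R ⊗[k] S) '' (TwoSidedIdeal.jacobson (⊥ : TwoSidedIdeal S))) := by
  have hT : ∀ (T : Type) [Ring T] (x : T),
      x ∈ TwoSidedIdeal.jacobson (⊥ : TwoSidedIdeal T) ↔ x ∈ Ring.jacobson T := by
    intro T _ x
    simp [TwoSidedIdeal.jacobson, Ideal.jacobson_bot]
  apply le_antisymm
  · intro x hx
    rw [hT] at hx
    have : IsArtinianRing R := IsArtinianRing.of_finite k R
    have : IsArtinianRing S := IsArtinianRing.of_finite k S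
    let f := Ideal.Quotient.mkₐ k (Ring.jacobson R)
    let g := Ideal.Quotient.mkₐ k (Ring.jacobson S)
    have hf : Function.Surjective f := Ideal.Quotient.mk_surjective
    have hg : Function.Surjective g := Ideal.Quotient.mk_surjective
    have : IsSemisimpleRing (R ⧸ Ring.jacobson R) := IsSemiprimaryRing.isSemisimpleRing
    have : IsSemisimpleRing (S ⧸ Ring.jacobson S) := IsSemiprimaryRing.isSemisimpleRing
    have hker : x ∈ RingHom.ker (Algebra.TensorProduct.map f g) := by
      have hs : Function.Surjective (Algebra.TensorProduct.map f g).toRingHom :=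
        TensorProduct.map_surjective hf hg
      have : RingHomSurjective (Algebra.TensorProduct.map f g).toRingHom := ⟨hs⟩
      have := Ring.le_comap_jacobson (Algebra.TensorProduct.map f g).toRingHom hx
      rw [tensor_jacobson] at this
      exact this
    rw [Algebra.TensorProduct.map_ker f g hf hg] at hker
    rw [← TwoSidedIdeal.mem_asIdeal]
    revert hker
    apply SetLike.le_def.1
    refine sup_le ?_ ?_
    · rw [Ideal.map_le_iff_le_comap]
      intro r hr
      refine TwoSidedIdeal.mem_sup_left (TwoSidedIdeal.subset_span ⟨r, ?_, rfl⟩)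
      rw [SetLike.mem_coe, hT]
      exact Ideal.Quotient.eq_zero_iff_mem.1 hr
    · rw [Ideal.map_le_iff_le_comap]
      intro r hr
      refine TwoSidedIdeal.mem_sup_right (TwoSidedIdeal.subset_span ⟨r, ?_, rfl⟩)
      rw [SetLike.mem_coe, hT]
      exact Ideal.Quotient.eq_zero_iff_mem.1 hr
  · refine sup_le ?_ ?_
    · rw [TwoSidedIdeal.span_le]
      rintro _ ⟨x, hx, rfl⟩
      refine incl_mem (k := k) Algebra.TensorProduct.includeLeft
        (Algebra.TensorProduct.includeRight : S →ₐ[k] R ⊗[k] S) ?_ ?_ x hx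
      · intro r s
        simp [Commute, SemiconjBy]
      · intro t
        induction t with
        | zero => exact zero_mem _
        | add x y hx hy => exact add_mem hx hy
        | tmul r s =>
          have : r ⊗ₜ[k] s = (1 ⊗ₜ s) * (r ⊗ₜ 1) := by simp
          rw [this]
          exact Submodule.mul_mem_mul ⟨s, trivial, rfl⟩ ⟨r, trivial, rfl⟩
    · rw [TwoSidedIdeal.span_le]
      rintro _ ⟨x, hx, rfl⟩
      refine incl_mem (k := k) Algebra.TensorProduct.includeRight
        (Algebra.TensorProduct.includeLeft : R →ₐ[k] R ⊗[k] S) ?_ ?_ x hx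
      · intro r s
        simp [Commute, SemiconjBy]
      · intro t
        induction t with
        | zero => exact zero_mem _
        | add x y hx hy => exact add_mem hx hy
        | tmul r s =>
          have : r ⊗ₜ[k] s = (r ⊗ₜ 1) * (1 ⊗ₜ s) := by simp
          rw [this]
          exact Submodule.mul_mem_mul ⟨r, trivial, rfl⟩ ⟨s, trivial, rfl⟩
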